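/- arXiv:2209.12126 — 6 statements merged into one kernel-verified Lean document; each statement's English description precedes it below -/
import Mathlib

section
/- Let n ≥ 3 and 1 ≤ r ≤ n−2 be integers, let G be any n-dimensional hypercube-like network (G ∈ HL_n), and let F be any set of edges of G with |F| ≤ 2^r·(n−r) − n such that the minimum degree of G − F is at least r. Then G − F is strongly Menger edge connected. -/
/-- `IsHL n G` : `G` is an `n`-dimensional hypercube-like network (`G ∈ HL_n`).
`HL_0 = {K_1}`, and `G ∈ HL_n` iff the vertex set can be partitioned into `S` and `Sᶜ`
with both induced subgraphs in `HL_{n-1}` and the edges between `S` and `Sᶜ`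
forming a perfect matching between them. -/
def IsHL : (n : ℕ) → {V : Type} → [Fintype V] → [DecidableEq V] → SimpleGraph V → Prop
  | 0, V, _, _, _ => Fintype.card V = 1
  | n + 1, _, _, _, G =>
      ∃ S : Finset _,
        IsHL n (G.induce (S : Set _)) ∧
        IsHL n (G.induce ((Sᶜ : Finset _) : Set _)) ∧
        (∀ v ∈ S, ∃! w, w ∉ S ∧ G.Adj v w) ∧
        (∀ v ∉ S, ∃! w, w ∈ S ∧ G.Adj v w)

/-- `H` is strongly Menger edge connected (SM-λ): `H` is connected and, for every pair of
distinct vertices `u, v`, no set of fewer than `min (deg u) (deg v)` edges of `H`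
separates `u` from `v` (equivalently, by Menger's theorem, `u` and `v` are joined by
`min (deg u) (deg v)` pairwise edge-disjoint paths). -/
def IsSMLambda {V : Type} [Fintype V] (H : SimpleGraph V) : Prop :=
  H.Connected ∧
    ∀ u v : V, u ≠ v →
      ∀ D : Set (Sym2 V), D ⊆ H.edgeSet →
        D.ncard < min (H.neighborSet u).ncard (H.neighborSet v).ncard →
          (H.deleteEdges D).Reachable u v

/-- The largest number of edges that `m` vertices of a hypercube-like network can span. -/
def maxEdges : ℕ → ℕ
  | 0 => 0
  | 1 => 0
  | m + 2 => maxEdges ((m + 2) / 2) + maxEdges ((m + 3) / 2) + (m + 2) / 2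
decreasing_by all_goals omega

theorem maxEdges_zero : maxEdges 0 = 0 := by rw [maxEdges]

theorem maxEdges_one : maxEdges 1 = 0 := by rw [maxEdges]

theorem maxEdges_two_mul (k : ℕ) : maxEdges (2 * k) = 2 * maxEdges k + k := by
  rcases k with _ | k
  · simp [maxEdges_zero]
  · rw [show 2 * (k + 1) = 2 * k + 2 by ring, maxEdges,
      show (2 * k + 2) / 2 = k + 1 by omega, show (2 * k + 3) / 2 = k + 1 by omega]
    ring

theorem maxEdges_two_mul_add_one (k : ℕ) :
    maxEdges (2 * k + 1) = maxEdges k + maxEdges (k + 1) + k := by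
  rcases k with _ | k
  · simp [maxEdges_zero, maxEdges_one]
  · rw [show 2 * (k + 1) + 1 = 2 * k + 1 + 2 by ring, maxEdges,
      show (2 * k + 1 + 2) / 2 = k + 1 by omega, show (2 * k + 1 + 3) / 2 = k + 1 + 1 by omega]

theorem maxEdges_add_le (a b : ℕ) :
    maxEdges a + maxEdges b + min a b ≤ maxEdges (a + b) := by
  induction hs : a + b using Nat.strong_induction_on generalizing a b with
  | _ s ih =>
    subst hs
    rcases Nat.eq_zero_or_pos a with rfl | ha
    · simp [maxEdges_zero]
    rcases Nat.eq_zero_or_pos b with rfl | hb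
    · simp [maxEdges_zero]
    rcases Nat.even_or_odd' a with ⟨x, rfl | rfl⟩ <;> rcases Nat.even_or_odd' b with ⟨y, rfl | rfl⟩
    · have h := ih (x + y) (by omega) x y rfl
      rw [← mul_add, maxEdges_two_mul, maxEdges_two_mul, maxEdges_two_mul]
      omega
    · have h := ih (x + y) (by omega) x y rfl
      have h' := ih (x + (y + 1)) (by omega) x (y + 1) rfl
      rw [show 2 * x + (2 * y + 1) = 2 * (x + y) + 1 by ring, maxEdges_two_mul,
        maxEdges_two_mul_add_one, maxEdges_two_mul_add_one]
      rw [← add_assoc] at h'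
      omega
    · have h := ih (x + y) (by omega) x y rfl
      have h' := ih (x + 1 + y) (by omega) (x + 1) y rfl
      rw [show 2 * x + 1 + 2 * y = 2 * (x + y) + 1 by ring, maxEdges_two_mul,
        maxEdges_two_mul_add_one, maxEdges_two_mul_add_one]
      rw [add_right_comm x 1 y] at h'
      omega
    · have h := ih (x + (y + 1)) (by omega) x (y + 1) rfl
      have h' := ih (x + 1 + y) (by omega) (x + 1) y rfl
      rw [show 2 * x + 1 + (2 * y + 1) = 2 * (x + y + 1) by ring, maxEdges_two_mul,
        maxEdges_two_mul_add_one, maxEdges_two_mul_add_one]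
      rw [add_right_comm x 1 y] at h'
      rw [← add_assoc] at h
      omega

theorem two_mul_maxEdges_two_pow (r : ℕ) : 2 * maxEdges (2 ^ r) = r * 2 ^ r := by
  induction r with
  | zero => simp [maxEdges_one]
  | succ r ih =>
    rw [pow_succ', maxEdges_two_mul, mul_add, mul_left_comm, ih]
    ring

theorem two_mul_maxEdges_add_le {r m : ℕ} (hm : 1 ≤ m) (hmr : m < 2 ^ r) :
    2 * maxEdges m + r ≤ r * m := by
  induction r generalizing m with
  | zero => simp at hmr; omega
  | succ r ih =>
    rw [pow_succ'] at hmr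
    rcases Nat.even_or_odd' m with ⟨k, rfl | rfl⟩
    · have h := ih (m := k) (by omega) (by omega)
      rw [maxEdges_two_mul]
      have hr : 1 ≤ r := by
        by_contra! h0
        obtain rfl : r = 0 := by omega
        simp at hmr
        omega
      nlinarith
    · rcases Nat.eq_zero_or_pos k with rfl | hk
      · simp [maxEdges_one]
      have h := ih (m := k) (by omega) (by omega)
      rw [maxEdges_two_mul_add_one]
      rcases lt_or_ge (k + 1) (2 ^ r) with h1 | h1
      · have h' := ih (m := k + 1) (by omega) h1
        nlinarith
      · have h' := two_mul_maxEdges_two_pow r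
        obtain h2 : 2 ^ r = k + 1 := by omega
        rw [h2] at h'
        nlinarith

theorem add_two_mul_maxEdges_le {n m : ℕ} (hm : 1 ≤ m) (hmn : m ≤ 2 ^ n) :
    (n + 1) + 2 * maxEdges m ≤ (n + 1) * m := by
  induction n generalizing m with
  | zero =>
    obtain rfl : m = 1 := by simp at hmn; omega
    simp [maxEdges_one]
  | succ n ih =>
    rw [pow_succ'] at hmn
    rcases Nat.even_or_odd' m with ⟨k, rfl | rfl⟩
    · have h := ih (m := k) (by omega) (by omega)
      rw [maxEdges_two_mul]
      nlinarith
    · rcases Nat.eq_zero_or_pos k with rfl | hk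
      · simp [maxEdges_one]
      have h := ih (m := k) (by omega) (by omega)
      have h' := ih (m := k + 1) (by omega) (by omega)
      rw [maxEdges_two_mul_add_one]
      nlinarith

/-- The edge-isoperimetric estimate: sets of size between `2 ^ r` and half of the network
have at least as large a boundary as an `r`-dimensional subnetwork. -/
theorem two_pow_mul_add_two_mul_maxEdges_le {r k m : ℕ} (hm : 2 ^ r ≤ m)
    (hmn : m ≤ 2 ^ (r + k)) :
    2 ^ r * (k + 1) + 2 * maxEdges m ≤ (r + k + 1) * m := by
  induction r generalizing m with
  | zero =>
    simp only [pow_zero, zero_add, one_mul] at hm hmn ⊢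
    exact add_two_mul_maxEdges_le hm hmn
  | succ r ih =>
    rw [pow_succ'] at hm
    rw [show r + 1 + k = r + k + 1 by ring, pow_succ'] at hmn
    rw [pow_succ']
    rcases Nat.even_or_odd' m with ⟨j, rfl | rfl⟩
    · have h := ih (m := j) (by omega) (by omega)
      rw [maxEdges_two_mul]
      nlinarith
    · have h := ih (m := j) (by omega) (by omega)
      have h' := ih (m := j + 1) (by omega) (by omega)
      rw [maxEdges_two_mul_add_one]
      nlinarith

open Classical in
/-- The number of ordered adjacent pairs in `X × Y`. -/
noncomputable def adjCount {V : Type} (K : SimpleGraph V) (X Y : Finset V) : ℕ :=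
  ∑ x ∈ X, (Y.filter (K.Adj x)).card

section AdjCount

variable {V : Type} (K : SimpleGraph V)

theorem adjCount_comm (X Y : Finset V) : adjCount K X Y = adjCount K Y X := by
  classical
  simp only [adjCount, Finset.card_filter]
  rw [Finset.sum_comm]
  simp only [K.adj_comm]

theorem adjCount_union_left [DecidableEq V] {A B : Finset V} (h : Disjoint A B)
    (Y : Finset V) : adjCount K (A ∪ B) Y = adjCount K A Y + adjCount K B Y := by
  simp only [adjCount, Finset.sum_union h]

theorem adjCount_union_right [DecidableEq V] {A B : Finset V} (h : Disjoint A B)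
    (X : Finset V) : adjCount K X (A ∪ B) = adjCount K X A + adjCount K X B := by
  rw [adjCount_comm, adjCount_union_left K h, adjCount_comm K A, adjCount_comm K B]

theorem adjCount_univ [Fintype V] (X : Finset V) :
    adjCount K X Finset.univ = ∑ x ∈ X, (K.neighborSet x).ncard := by
  classical
  refine Finset.sum_congr rfl fun x _ ↦ ?_
  rw [← Set.ncard_coe_finset]
  congr 1
  ext y
  simp

theorem adjCount_add_compl [Fintype V] [DecidableEq V] (X : Finset V) :
    adjCount K X X + adjCount K X Xᶜ = ∑ x ∈ X, (K.neighborSet x).ncard := by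
  rw [← adjCount_univ, ← adjCount_union_right K disjoint_compl_right, Finset.union_compl]

variable {K}

theorem adjCount_mono {K' : SimpleGraph V} (h : K ≤ K') (X Y : Finset V) :
    adjCount K X Y ≤ adjCount K' X Y := by
  classical
  refine Finset.sum_le_sum fun x _ ↦ Finset.card_le_card fun y hy ↦ ?_
  simp only [Finset.mem_filter] at hy ⊢
  exact ⟨hy.1, h hy.2⟩

theorem adjCount_le_card {X Y : Finset V}
    (h : ∀ x ∈ X, ∀ y ∈ Y, ∀ z ∈ Y, K.Adj x y → K.Adj x z → y = z) :
    adjCount K X Y ≤ X.card := by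
  classical
  rw [adjCount, Finset.card_eq_sum_ones]
  refine Finset.sum_le_sum fun x hx ↦ Finset.card_le_one.2 fun y hy z hz ↦ ?_
  simp only [Finset.mem_filter] at hy hz
  exact h x hx y hy.1 z hz.1 hy.2 hz.2

/-- The pairs counted between disjoint sets come from distinct edges. -/
theorem adjCount_le_ncard [Finite V] {X Y : Finset V} (hXY : Disjoint X Y) {D : Set (Sym2 V)}
    (h : ∀ x ∈ X, ∀ y ∈ Y, K.Adj x y → s(x, y) ∈ D) : adjCount K X Y ≤ D.ncard := by
  classical
  have hcount : adjCount K X Y = ((X ×ˢ Y).filter fun p ↦ K.Adj p.1 p.2).card := by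
    simp only [adjCount, Finset.card_filter, Finset.sum_product]
  rw [hcount, ← Set.ncard_coe_finset]
  refine Set.ncard_le_ncard_of_injOn (fun p ↦ s(p.1, p.2)) ?_ ?_ (Set.toFinite D)
  · rintro ⟨x, y⟩ hp
    simp only [Finset.coe_filter, Finset.mem_product, Set.mem_ofPred_eq] at hp
    exact h x hp.1.1 y hp.1.2 hp.2
  · rintro ⟨x, y⟩ hp ⟨x', y'⟩ hp' he
    simp only [Finset.coe_filter, Finset.mem_product, Set.mem_ofPred_eq] at hp hp'
    rcases Sym2.eq_iff.1 he with ⟨rfl, rfl⟩ | ⟨rfl, rfl⟩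
    · rfl
    · exact absurd hp'.1.2 (Finset.disjoint_left.1 hXY hp.1.1)

theorem adjCount_map {W : Type} (f : W ↪ V) (X Y : Finset W) :
    adjCount K (X.map f) (Y.map f) = adjCount (K.comap f) X Y := by
  classical
  simp only [adjCount, Finset.sum_map, Finset.filter_map, Finset.card_map]
  rfl

end AdjCount

theorem IsHL.card_eq {n : ℕ} {V : Type} [Fintype V] [DecidableEq V] {G : SimpleGraph V}
    (hG : IsHL n G) : Fintype.card V = 2 ^ n := by
  induction n generalizing V with
  | zero => simpa [IsHL] using hG
  | succ n ih =>
    obtain ⟨S, h₁, h₂, -, -⟩ := hG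
    have e₁ := ih h₁
    have e₂ := ih h₂
    rw [← Nat.card_eq_fintype_card, Nat.card_coe_set_eq, Set.ncard_coe_finset] at e₁ e₂
    rw [← S.card_add_card_compl, e₁, e₂]
    ring

theorem ncard_neighborSet_of_induce {V : Type} [Finite V] {G : SimpleGraph V} {s : Set V}
    {v : V} (hv : v ∈ s) (h : ∃! w, w ∉ s ∧ G.Adj v w) :
    (G.neighborSet v).ncard = ((G.induce s).neighborSet ⟨v, hv⟩).ncard + 1 := by
  obtain ⟨w, ⟨hw, hvw⟩, huniq⟩ := h
  rw [← Set.ncard_image_of_injective _ Subtype.val_injective, ← Set.ncard_insert_of_notMem (a := w)]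
  · congr 1
    ext x
    simp only [SimpleGraph.mem_neighborSet, Set.mem_insert_iff, Set.mem_image, Subtype.exists,
      SimpleGraph.comap_adj, Function.Embedding.subtype_apply, exists_and_left, exists_prop,
      exists_eq_right_right]
    constructor
    · intro hx
      by_cases hxs : x ∈ s
      · exact Or.inr ⟨hx, hxs⟩
      · exact Or.inl (huniq x ⟨hxs, hx⟩)
    · rintro (rfl | ⟨hx, -⟩)
      exacts [hvw, hx]
  · rintro ⟨⟨x, hx⟩, -, rfl⟩
    exact hw hx

theorem IsHL.ncard_neighborSet {n : ℕ} {V : Type} [Fintype V] [DecidableEq V]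
    {G : SimpleGraph V} (hG : IsHL n G) (v : V) : (G.neighborSet v).ncard = n := by
  induction n generalizing V with
  | zero =>
    have : Subsingleton V := Fintype.card_le_one_iff_subsingleton.1 (le_of_eq hG)
    rw [Set.ncard_eq_zero]
    exact Set.eq_empty_of_forall_notMem fun w hw ↦ G.ne_of_adj hw (Subsingleton.elim v w)
  | succ n ih =>
    obtain ⟨S, h₁, h₂, h₃, h₄⟩ := hG
    by_cases hv : v ∈ S
    · rw [ncard_neighborSet_of_induce (s := (S : Set V)) hv (by simpa using h₃ v hv), ih h₁]
    · rw [ncard_neighborSet_of_induce (s := ((Sᶜ : Finset V) : Set V)) (by simpa using hv)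
        (by simpa using h₄ v hv), ih h₂]

theorem IsHL.adjCount_le {n : ℕ} {V : Type} [Fintype V] [DecidableEq V]
    {G : SimpleGraph V} (hG : IsHL n G) (X : Finset V) :
    adjCount G X X ≤ 2 * maxEdges X.card := by
  induction n generalizing V with
  | zero =>
    classical
    have : Subsingleton V := Fintype.card_le_one_iff_subsingleton.1 (le_of_eq hG)
    refine le_trans (le_of_eq ?_) (Nat.zero_le _)
    refine Finset.sum_eq_zero fun x _ ↦ Finset.card_eq_zero.2 ?_
    exact Finset.filter_eq_empty_iff.2 fun y _ h ↦ G.ne_of_adj h (Subsingleton.elim x y)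
  | succ n ih =>
    obtain ⟨S, h₁, h₂, h₃, h₄⟩ := hG
    have key : ∀ T : Finset V, IsHL n (G.induce (T : Set V)) →
        ∀ Y ⊆ T, adjCount G Y Y ≤ 2 * maxEdges Y.card := by
      intro T hT Y hY
      have hmap : (Y.subtype (· ∈ (T : Set V))).map (Function.Embedding.subtype _) = Y :=
        Finset.subtype_map_of_mem fun x hx ↦ hY hx
      have := ih hT (Y.subtype (· ∈ (T : Set V)))
      rw [← Finset.card_map (Function.Embedding.subtype _), hmap] at this
      rw [← hmap, adjCount_map, hmap]
      exact this
    set A := X ∩ S with hA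
    set B := X \ S with hB
    have hAB : Disjoint A B := (Finset.disjoint_sdiff_inter X S).symm
    have hX : X = A ∪ B := by rw [Finset.union_comm]; exact (Finset.sdiff_union_inter X S).symm
    have hAA := key S h₁ A Finset.inter_subset_right
    have hBB := key Sᶜ h₂ B fun x hx ↦ by simp [hB] at hx ⊢; exact hx.2
    have h5 : adjCount G A B ≤ A.card := adjCount_le_card fun x hx y hy z hz hxy hxz ↦ by
      simp only [hA, hB, Finset.mem_inter, Finset.mem_sdiff] at hx hy hz
      exact (h₃ x hx.2).unique ⟨hy.2, hxy⟩ ⟨hz.2, hxz⟩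
    have h6 : adjCount G B A ≤ B.card := adjCount_le_card fun x hx y hy z hz hxy hxz ↦ by
      simp only [hA, hB, Finset.mem_inter, Finset.mem_sdiff] at hx hy hz
      exact (h₄ x hx.2).unique ⟨hy.2, hxy⟩ ⟨hz.2, hxz⟩
    have h7 := adjCount_comm G A B
    have h8 := maxEdges_add_le A.card B.card
    rw [hX, adjCount_union_left G hAB, adjCount_union_right G hAB, adjCount_union_right G hAB,
      Finset.card_union_of_disjoint hAB]
    omega

/-- A set of at most half of the vertices that is a union of components of `G - F - D`
cannot contain a vertex whose degree in `G - F` exceeds `|D|`. -/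
theorem IsHL.ncard_neighborSet_deleteEdges_le {n r : ℕ} (hr : r + 1 ≤ n)
    {V : Type} [Fintype V] [DecidableEq V] {G : SimpleGraph V} (hG : IsHL n G)
    {F D : Set (Sym2 V)} (hF : (F.ncard : ℤ) ≤ 2 ^ r * ((n : ℤ) - r) - n)
    (hdeg : ∀ v : V, r ≤ ((G.deleteEdges F).neighborSet v).ncard)
    {X : Finset V} (hX : X.card ≤ 2 ^ (n - 1)) {u : V} (hu : u ∈ X)
    (hcut : ∀ x ∈ X, ∀ y ∉ X, ¬((G.deleteEdges F).deleteEdges D).Adj x y) :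
    ((G.deleteEdges F).neighborSet u).ncard ≤ D.ncard := by
  by_contra! hlt
  have hinner := hG.adjCount_le X
  have hle : G.deleteEdges F ≤ G := SimpleGraph.deleteEdges_le F
  have hpos : 1 ≤ X.card := Finset.card_pos.2 ⟨u, hu⟩
  rcases lt_or_ge X.card (2 ^ r) with hsmall | hlarge
  · have hout : adjCount (G.deleteEdges F) X Xᶜ ≤ D.ncard := by
      refine adjCount_le_ncard disjoint_compl_right fun x hx y hy hxy ↦ ?_
      by_contra hD
      exact hcut x hx y (by simpa using hy) (SimpleGraph.deleteEdges_adj.2 ⟨hxy, hD⟩)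
    have hsum := adjCount_add_compl (G.deleteEdges F) X
    have hmono := adjCount_mono hle X X
    have hmax := two_mul_maxEdges_add_le hpos hsmall
    have hrest : (X.erase u).card * r ≤
        ∑ x ∈ X.erase u, ((G.deleteEdges F).neighborSet x).ncard := by
      simpa using Finset.card_nsmul_le_sum (X.erase u) _ r fun x _ ↦ hdeg x
    rw [← Finset.add_sum_erase X _ hu] at hsum
    rw [Finset.card_erase_of_mem hu, Nat.sub_mul, one_mul, mul_comm] at hrest
    omega
  · have hout : adjCount G X Xᶜ ≤ (F ∪ D).ncard := by
      refine adjCount_le_ncard disjoint_compl_right fun x hx y hy hxy ↦ ?_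
      by_contra hFD
      rw [Set.mem_union, not_or] at hFD
      exact hcut x hx y (by simpa using hy)
        (SimpleGraph.deleteEdges_adj.2 ⟨SimpleGraph.deleteEdges_adj.2 ⟨hxy, hFD.1⟩, hFD.2⟩)
    have hunion := Set.ncard_union_le F D
    have hsum := adjCount_add_compl G X
    simp only [hG.ncard_neighborSet, Finset.sum_const, smul_eq_mul] at hsum
    have hDn : D.ncard < n := by
      refine hlt.trans_le ?_
      rw [← hG.ncard_neighborSet u]
      exact Set.ncard_le_ncard (fun w hw ↦ hle hw) (Set.toFinite _)
    obtain ⟨k, rfl⟩ := Nat.exists_eq_add_of_le hr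
    have hiso := two_pow_mul_add_two_mul_maxEdges_le (k := k) hlarge
      (hX.trans_eq (by congr 1; omega))
    rw [mul_comm (r + k + 1)] at hiso
    rw [show r + 1 + k = r + k + 1 by ring] at hsum hDn hF
    have hF' : F.ncard + (r + k + 1) ≤ 2 ^ r * (k + 1) := by
      zify
      push_cast at hF
      rw [show (r : ℤ) + k + 1 - r = k + 1 by ring] at hF
      linarith
    omega

/-- Edge-fault-tolerance of the SM-λ property of HL-networks (lower bound direction):
if `G ∈ HL_n`, `|F| ≤ 2^r (n - r) - n` and `δ(G - F) ≥ r`, then `G - F` is SM-λ. -/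
theorem smLambda_of_deleteEdges_HL
    {n r : ℕ} (hn : 3 ≤ n) (hr1 : 1 ≤ r) (hr2 : r + 2 ≤ n)
    {V : Type} [Fintype V] [DecidableEq V] (G : SimpleGraph V) (hG : IsHL n G)
    (F : Set (Sym2 V)) (hFsub : F ⊆ G.edgeSet)
    (hFcard : (F.ncard : ℤ) ≤ 2 ^ r * ((n : ℤ) - r) - n)
    (hdeg : ∀ v : V, r ≤ ((G.deleteEdges F).neighborSet v).ncard) :
    IsSMLambda (G.deleteEdges F) := by
  classical
  have main : ∀ u v : V, ∀ D : Set (Sym2 V),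
      D.ncard < min ((G.deleteEdges F).neighborSet u).ncard
        ((G.deleteEdges F).neighborSet v).ncard →
      ((G.deleteEdges F).deleteEdges D).Reachable u v := by
    intro u v D hD
    rw [lt_min_iff] at hD
    by_contra huv
    set H := (G.deleteEdges F).deleteEdges D with hH
    set X : Finset V := Finset.univ.filter (H.Reachable u) with hX
    have hcut : ∀ x ∈ X, ∀ y ∉ X, ¬H.Adj x y := by
      intro x hx y hy hxy
      simp only [hX, Finset.mem_filter, Finset.mem_univ, true_and] at hx hy
      exact hy (hx.trans hxy.reachable)
    have hcard := X.card_add_card_compl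
    rw [hG.card_eq, show n = n - 1 + 1 by omega, pow_succ] at hcard
    rcases le_or_gt X.card (2 ^ (n - 1)) with hle | hgt
    · exact hD.1.not_ge (hG.ncard_neighborSet_deleteEdges_le (by omega) hFcard hdeg hle
        (by simp [hX]) hcut)
    · refine hD.2.not_ge (hG.ncard_neighborSet_deleteEdges_le (X := Xᶜ) (by omega) hFcard hdeg
        (by omega) (by simpa [hX] using huv) fun x hx y hy hxy ↦ ?_)
      exact hcut y (by simpa using hy) x (by simpa using hx) hxy.symm
  have : Nonempty V := Fintype.card_pos_iff.1 (by rw [hG.card_eq]; positivity)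
  refine ⟨⟨fun u v ↦ ?_⟩, fun u v _ D _ hD ↦ main u v D hD⟩
  have h := main u v ∅ (by
    rw [Set.ncard_empty]
    exact lt_min (hr1.trans (hdeg u)) (hr1.trans (hdeg v)))
  rwa [SimpleGraph.deleteEdges_empty] at h
end

section
/- Let n ≥ 3 and 1 ≤ r ≤ n−2 be integers, let G be any n-dimensional hypercube-like network (G ∈ HL_n), and let F be any set of edges of G with |F| ≤ 2^r·(n−r) − n such that the minimum degree of G − F is at least r. Then G − F is connected. -/
/-- The function `x ↦ x log x` satisfies the recursion behind the edge-isoperimetric inequality. -/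
lemma mul_log_add_mul_log_add_two_mul_le {a b : ℝ} (ha : 0 ≤ a) (hab : a ≤ b) :
    a * Real.log a + b * Real.log b + 2 * a * Real.log 2 ≤ (a + b) * Real.log (a + b) := by
  rcases ha.eq_or_lt with rfl | ha
  · simp
  have hb : 0 < b := ha.trans_le hab
  have hc := Real.convexOn_mul_log.2 (x := a) (y := a + b) ha.le (by simp; positivity)
  have h1 := hc (a := 1 - a / b) (b := a / b)
    (by rw [sub_nonneg, div_le_one hb]; exact hab) (by positivity) (by ring)
  have h2 := hc (a := a / b) (b := 1 - a / b)
    (by positivity) (by rw [sub_nonneg, div_le_one hb]; exact hab) (by ring)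
  simp only [smul_eq_mul] at h1 h2
  have e1 : (1 - a / b) * a + a / b * (a + b) = 2 * a := by field_simp; ring
  have e2 : a / b * a + (1 - a / b) * (a + b) = b := by field_simp; ring
  rw [e1, Real.log_mul two_ne_zero ha.ne'] at h1
  rw [e2] at h2
  linarith

/-- `x ↦ x log x` on a segment lies below the linear function bounding it at the endpoints. -/
lemma two_pow_mul_sub_le_of_mem_Icc {n r : ℕ} (hr : r + 1 ≤ n) {x : ℝ}
    (h1 : (2 : ℝ) ^ r ≤ x) (h2 : x ≤ 2 ^ (n - 1)) :
    (2 : ℝ) ^ r * (n - r) * Real.log 2 ≤ x * n * Real.log 2 - x * Real.log x := by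
  obtain ⟨m, rfl⟩ : ∃ m, n = r + 1 + m := ⟨n - (r + 1), by omega⟩
  have hconv : ConvexOn ℝ (Set.Ici 0) (fun x : ℝ => x * Real.log x -
      (((r + 1 + m : ℕ) : ℝ) * Real.log 2) * x) := by
    refine Real.convexOn_mul_log.sub ((LinearMap.mulLeft ℝ
      (((r + 1 + m : ℕ) : ℝ) * Real.log 2)).concaveOn (convex_Ici 0))
  have hmax := hconv.le_max_of_mem_Icc (x := 2 ^ r) (y := 2 ^ (r + 1 + m - 1)) (z := x)
    (by simp) (by simp) ⟨h1, h2⟩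
  have hlog : 0 < Real.log 2 := Real.log_pos one_lt_two
  have hm : ((m : ℝ) + 1) ≤ 2 ^ m := by exact_mod_cast Nat.lt_two_pow_self (n := m)
  have hpow : (0 : ℝ) < 2 ^ r := by positivity
  have key : (2 : ℝ) ^ r * (m + 1) * Real.log 2 ≤ 2 ^ r * 2 ^ m * Real.log 2 := by gcongr
  rw [show r + 1 + m - 1 = r + m by omega] at hmax
  simp only [Real.log_pow] at hmax
  push_cast at hmax ⊢
  rw [pow_add] at hmax
  rcases le_max_iff.1 hmax with h | h <;> nlinarith

open Finset

section Counting

variable {V : Type}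

/-- A bound, by either side, on the number of edges of a relation with at most one partner
for every vertex. -/
lemma sum_card_filter_le_card_min (R : V → V → Prop) [DecidableRel R] (A B : Finset V)
    (hA : ∀ u ∈ A, #{w ∈ B | R u w} ≤ 1) (hB : ∀ w ∈ B, #{u ∈ A | R u w} ≤ 1) :
    ∑ u ∈ A, #{w ∈ B | R u w} ≤ min #A #B := by
  refine le_min ?_ ?_
  · simpa using sum_le_card_nsmul A _ 1 hA
  · have h := sum_card_bipartiteAbove_eq_sum_card_bipartiteBelow (s := A) (t := B) R
    simp only [bipartiteAbove, bipartiteBelow] at h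
    rw [h]
    simpa using sum_le_card_nsmul B _ 1 hB

lemma card_subtype_of_mem (T : Set V) [DecidablePred (· ∈ T)] (X : Finset V)
    (hX : ∀ x ∈ X, x ∈ T) : #(X.subtype (· ∈ T)) = #X := by
  conv_rhs => rw [← subtype_map_of_mem hX, card_map]

variable (G : SimpleGraph V) [DecidableRel G.Adj]

/-- The degree sum inside a set, computed in an induced subgraph. -/
lemma sum_card_filter_induce_adj (T : Set V) [DecidablePred (· ∈ T)] (X : Finset V)
    (hX : ∀ x ∈ X, x ∈ T) [DecidableRel (G.induce T).Adj] :
    ∑ u ∈ X.subtype (· ∈ T), #{w ∈ X.subtype (· ∈ T) | (G.induce T).Adj u w} =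
      ∑ u ∈ X, #{w ∈ X | G.Adj u w} := by
  conv_rhs => rw [← subtype_map_of_mem hX, sum_map]
  refine sum_congr rfl fun u _ => ?_
  conv_rhs => rw [filter_map, card_map]
  congr 1
  ext w
  exact (@mem_filter _ _ (_) _ _).trans (@mem_filter _ _ (_) _ _).symm

/-- The number of neighbours of `u` in an induced subgraph. -/
lemma card_filter_induce_adj [Fintype V] (T : Set V) [Fintype T]
    [DecidableRel (G.induce T).Adj] [DecidablePred (· ∈ T)] (u : T) :
    #{w | (G.induce T).Adj u w} = #{w | w ∈ T ∧ G.Adj u w} := by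
  rw [← card_map (Function.Embedding.subtype (· ∈ T))]
  congr 1
  ext w
  simp [and_comm]

variable [DecidableEq V]

/-- Degrees inside a set decompose along a bipartition of the vertices. -/
lemma card_filter_adj_inter_add_sdiff (X S : Finset V) (u : V) :
    #{w ∈ X | G.Adj u w} = #{w ∈ X ∩ S | G.Adj u w} + #{w ∈ X \ S | G.Adj u w} := by
  conv_lhs => rw [← sdiff_union_inter X S, filter_union,
    card_union_of_disjoint (disjoint_filter_filter (disjoint_sdiff_inter X S))]
  exact add_comm _ _

/-- If every vertex has at most one neighbour across the bipartition given by `S`, then the degree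
sum inside `X` splits into those of the two parts, plus twice the number of crossing edges. -/
lemma sum_card_filter_adj_le (S X : Finset V)
    (h1 : ∀ v ∈ S, ∃! w, w ∉ S ∧ G.Adj v w) (h2 : ∀ v ∉ S, ∃! w, w ∈ S ∧ G.Adj v w) :
    ∑ u ∈ X, #{w ∈ X | G.Adj u w} ≤
      ∑ u ∈ X ∩ S, #{w ∈ X ∩ S | G.Adj u w} + ∑ u ∈ X \ S, #{w ∈ X \ S | G.Adj u w} +
        2 * min #(X ∩ S) #(X \ S) := by
  have c1 : ∀ u ∈ X ∩ S, #{w ∈ X \ S | G.Adj u w} ≤ 1 := by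
    intro u hu
    rw [card_le_one]
    intro a ha b hb
    simp only [mem_filter, mem_sdiff, mem_inter] at ha hb hu
    exact (h1 u hu.2).unique ⟨ha.1.2, ha.2⟩ ⟨hb.1.2, hb.2⟩
  have c2 : ∀ u ∈ X \ S, #{w ∈ X ∩ S | G.Adj u w} ≤ 1 := by
    intro u hu
    rw [card_le_one]
    intro a ha b hb
    simp only [mem_filter, mem_sdiff, mem_inter] at ha hb hu
    exact (h2 u hu.2).unique ⟨ha.1.2, ha.2⟩ ⟨hb.1.2, hb.2⟩
  have d1 := sum_card_filter_le_card_min G.Adj (X ∩ S) (X \ S) c1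
    (by simpa only [G.adj_comm] using c2)
  have d2 := sum_card_filter_le_card_min G.Adj (X \ S) (X ∩ S) c2
    (by simpa only [G.adj_comm] using c1)
  rw [min_comm] at d2
  calc ∑ u ∈ X, #{w ∈ X | G.Adj u w}
      = ∑ u ∈ X \ S, #{w ∈ X | G.Adj u w} + ∑ u ∈ X ∩ S, #{w ∈ X | G.Adj u w} := by
        rw [← sum_union (disjoint_sdiff_inter X S), sdiff_union_inter]
    _ ≤ _ := by
        simp only [card_filter_adj_inter_add_sdiff G X S, sum_add_distrib]
        omega

end Counting

namespace IsHL

lemma card_eq_s3 {n : ℕ} : ∀ {V : Type} [Fintype V] [DecidableEq V] {G : SimpleGraph V},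
    IsHL n G → Fintype.card V = 2 ^ n := by
  induction n with
  | zero => intro V _ _ G h; simpa [IsHL] using h
  | succ n ih =>
    rintro V _ _ G ⟨S, hS, hT, -, -⟩
    have e1 := ih hS
    have e2 := ih hT
    simp only [coe_sort_coe, Fintype.card_coe] at e1 e2
    rw [← card_add_card_compl S, e1, e2]
    ring

lemma card_filter_adj {n : ℕ} : ∀ {V : Type} [Fintype V] [DecidableEq V] {G : SimpleGraph V}
    [DecidableRel G.Adj], IsHL n G → ∀ u, #{w | G.Adj u w} = n := by
  classical
  induction n with
  | zero =>
    intro V _ _ G _ h u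
    have := Fintype.card_le_one_iff.1 (le_of_eq h)
    simp only [card_eq_zero, filter_eq_empty_iff]
    intro w _ hw
    exact hw.ne (this u w)
  | succ n ih =>
    rintro V _ _ G _ ⟨S, hS, hT, h1, h2⟩ u
    rw [card_filter_adj_inter_add_sdiff G univ S u]
    by_cases hu : u ∈ S
    · have e := card_filter_induce_adj G (S : Set V) ⟨u, hu⟩
      rw [ih hS] at e
      obtain ⟨w, hw, hw'⟩ := h1 u hu
      have e3 : ({w ∈ univ \ S | G.Adj u w} : Finset V) = {w} := by
        ext x
        simp only [mem_filter, mem_sdiff, mem_univ, true_and, mem_singleton]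
        exact ⟨hw' x, fun h => h ▸ hw⟩
      rw [e3, card_singleton, e]
      congr 2
      ext x
      simp
    · have e := card_filter_induce_adj G ((Sᶜ : Finset V) : Set V) ⟨u, by simpa using hu⟩
      rw [ih hT] at e
      obtain ⟨w, hw, hw'⟩ := h2 u hu
      have e3 : ({w ∈ univ ∩ S | G.Adj u w} : Finset V) = {w} := by
        ext x
        simp only [mem_filter, mem_inter, mem_univ, true_and, mem_singleton]
        exact ⟨hw' x, fun h => h ▸ hw⟩
      rw [e3, card_singleton, e, add_comm]
      congr 2
      ext x
      simp

/-- The edge-isoperimetric inequality: `k` vertices span at most `(k / 2) * log₂ k` edges. -/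
lemma sum_card_filter_adj_mul_log_two_le {n : ℕ} : ∀ {V : Type} [Fintype V] [DecidableEq V]
    {G : SimpleGraph V} [DecidableRel G.Adj], IsHL n G → ∀ X : Finset V,
    ((∑ u ∈ X, #{w ∈ X | G.Adj u w} : ℕ) : ℝ) * Real.log 2 ≤ #X * Real.log #X := by
  classical
  induction n with
  | zero =>
    intro V _ _ G _ h X
    have := Fintype.card_le_one_iff.1 (le_of_eq h)
    have e : ∑ u ∈ X, #{w ∈ X | G.Adj u w} = 0 := by
      simp only [sum_eq_zero_iff, card_eq_zero, filter_eq_empty_iff]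
      intro u _ w _ hw
      exact hw.ne (this u w)
    rw [e, Nat.cast_zero, zero_mul]
    exact mul_nonneg (Nat.cast_nonneg _) (Real.log_natCast_nonneg _)
  | succ n ih =>
    rintro V _ _ G _ ⟨S, hS, hT, h1, h2⟩ X
    have b1 := ih hS ((X ∩ S).subtype (· ∈ (S : Set V)))
    have b2 := ih hT ((X \ S).subtype (· ∈ ((Sᶜ : Finset V) : Set V)))
    rw [sum_card_filter_induce_adj _ _ _ (by simp), card_subtype_of_mem _ _ (by simp)] at b1 b2
    have b3 := sum_card_filter_adj_le G S X h1 h2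
    have hX : #X = #(X ∩ S) + #(X \ S) := (card_inter_add_card_sdiff X S).symm
    have hl : 0 < Real.log 2 := Real.log_pos one_lt_two
    rw [hX]
    have b4 : ((∑ u ∈ X, #{w ∈ X | G.Adj u w} : ℕ) : ℝ) * Real.log 2 ≤
        ((∑ u ∈ X ∩ S, #{w ∈ X ∩ S | G.Adj u w} + ∑ u ∈ X \ S, #{w ∈ X \ S | G.Adj u w} +
        2 * min #(X ∩ S) #(X \ S) : ℕ) : ℝ) * Real.log 2 := by gcongr
    refine b4.trans ?_
    rw [Nat.cast_add, Nat.cast_add, add_mul, add_mul]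
    rcases le_total #(X ∩ S) #(X \ S) with h | h
    · have := mul_log_add_mul_log_add_two_mul_le (Nat.cast_nonneg #(X ∩ S))
        (Nat.cast_le (α := ℝ).2 h)
      rw [min_eq_left h]
      push_cast at *
      linarith
    · have := mul_log_add_mul_log_add_two_mul_le (Nat.cast_nonneg #(X \ S))
        (Nat.cast_le (α := ℝ).2 h)
      rw [min_eq_right h, add_comm #(X ∩ S)]
      push_cast at *
      linarith

/-- A nonempty set of at most half of the vertices, of inner degree at least `r`, has an edge
boundary of size at least `2 ^ r * (n - r)`. -/
lemma two_pow_mul_le_sum_card_filter_compl {n r : ℕ} (hr : r + 1 ≤ n) {V : Type} [Fintype V]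
    [DecidableEq V] {G : SimpleGraph V} [DecidableRel G.Adj] (hG : IsHL n G) {X : Finset V}
    (hne : X.Nonempty) (hX : #X ≤ 2 ^ (n - 1)) (hdeg : ∀ u ∈ X, r ≤ #{w ∈ X | G.Adj u w}) :
    (2 : ℝ) ^ r * (n - r) ≤ (∑ u ∈ X, #{w ∈ Xᶜ | G.Adj u w} : ℕ) := by
  have hl : 0 < Real.log 2 := Real.log_pos one_lt_two
  have iso := hG.sum_card_filter_adj_mul_log_two_le X
  have hpos : (0 : ℝ) < #X := by exact_mod_cast hne.card_pos
  have hsum : #X * r ≤ ∑ u ∈ X, #{w ∈ X | G.Adj u w} := by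
    simpa using card_nsmul_le_sum X _ r hdeg
  have hsum' : (#X : ℝ) * r ≤ (∑ u ∈ X, #{w ∈ X | G.Adj u w} : ℕ) := by exact_mod_cast hsum
  have hlow : (2 : ℝ) ^ r ≤ #X := by
    rw [← Real.log_le_log_iff (by positivity) hpos, Real.log_pow]
    refine le_of_mul_le_mul_left ?_ hpos
    rw [← mul_assoc]
    exact (mul_le_mul_of_nonneg_right hsum' hl.le).trans iso
  have htot : (∑ u ∈ X, #{w ∈ X | G.Adj u w}) + ∑ u ∈ X, #{w ∈ Xᶜ | G.Adj u w} = #X * n := by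
    rw [← sum_add_distrib, ← smul_eq_mul]
    refine sum_eq_card_nsmul fun u _ => ?_
    rw [← hG.card_filter_adj u, card_filter_adj_inter_add_sdiff G univ X u, univ_inter,
      ← compl_eq_univ_sdiff]
  have htot' : ((∑ u ∈ X, #{w ∈ X | G.Adj u w} : ℕ) : ℝ) +
      (∑ u ∈ X, #{w ∈ Xᶜ | G.Adj u w} : ℕ) = #X * n := by exact_mod_cast htot
  have hmain := two_pow_mul_sub_le_of_mem_Icc hr hlow (by exact_mod_cast hX)
  refine le_of_mul_le_mul_right ?_ hl
  rw [← eq_sub_iff_add_eq'] at htot'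
  rw [htot', sub_mul]
  linarith

end IsHL

/-- The edge boundary of a set is no larger than an edge set containing it. -/
lemma sum_card_filter_compl_le_ncard {V : Type} [Fintype V] [DecidableEq V] (G : SimpleGraph V)
    [DecidableRel G.Adj] (X : Finset V) (F : Set (Sym2 V))
    (h : ∀ u ∈ X, ∀ w ∉ X, G.Adj u w → s(u, w) ∈ F) :
    ∑ u ∈ X, #{w ∈ Xᶜ | G.Adj u w} ≤ F.ncard := by
  rw [← card_sigma, ← Set.ncard_coe_finset]
  refine Set.ncard_le_ncard_of_injOn (fun p => s(p.1, p.2)) ?_ ?_ (Set.toFinite F)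
  · rintro ⟨u, w⟩ hp
    simp only [coe_sigma, Set.mem_sigma_iff, mem_coe, mem_filter, mem_compl] at hp
    exact h u hp.1 w hp.2.1 hp.2.2
  · rintro ⟨u, w⟩ hp ⟨u', w'⟩ hp' heq
    simp only [coe_sigma, Set.mem_sigma_iff, mem_coe, mem_filter, mem_compl] at hp hp'
    rcases Sym2.eq_iff.1 heq with ⟨rfl, rfl⟩ | ⟨rfl, rfl⟩
    · rfl
    · exact absurd hp.1 hp'.2.1

/-- If `G ∈ HL_n`, `|F| ≤ 2^r (n - r) - n` and `δ(G - F) ≥ r`, then `G - F` is connected,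
where `n ≥ 3` and `1 ≤ r ≤ n - 2`. -/
theorem connected_of_deleteEdges_HL
    {n r : ℕ} (hn : 3 ≤ n) (hr1 : 1 ≤ r) (hr2 : r + 2 ≤ n)
    {V : Type} [Fintype V] [DecidableEq V] (G : SimpleGraph V) (hG : IsHL n G)
    (F : Set (Sym2 V)) (hFsub : F ⊆ G.edgeSet)
    (hFcard : (F.ncard : ℤ) ≤ 2 ^ r * ((n : ℤ) - r) - n)
    (hdeg : ∀ v : V, r ≤ ((G.deleteEdges F).neighborSet v).ncard) :
    (G.deleteEdges F).Connected := by
  classical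
  have hcard := hG.card_eq_s3
  have : Nonempty V := by
    rw [← Fintype.card_pos_iff, hcard]
    positivity
  have big : ∀ X : Finset V, X.Nonempty →
      (∀ u ∈ X, ∀ w, (G.deleteEdges F).Adj u w → w ∈ X) → 2 ^ (n - 1) < #X := by
    intro X hne hcl
    by_contra! hX
    have h1 := hG.two_pow_mul_le_sum_card_filter_compl (r := r) (by omega) hne hX fun u hu => by
      refine (hdeg u).trans ?_
      rw [← Set.ncard_coe_finset]
      refine Set.ncard_le_ncard (fun w hw => ?_) (Set.toFinite _)
      simp only [coe_filter, Set.mem_ofPred_eq]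
      exact ⟨hcl u hu w hw, (G.deleteEdges_le F) hw⟩
    have h2 := sum_card_filter_compl_le_ncard G X F fun u hu w hw hadj => by
      by_contra hF
      exact hw (hcl u hu w (SimpleGraph.deleteEdges_adj.2 ⟨hadj, hF⟩))
    have h3 : (F.ncard : ℝ) ≤ 2 ^ r * ((n : ℝ) - r) - n := by exact_mod_cast hFcard
    have h4 : ((∑ u ∈ X, #{w ∈ Xᶜ | G.Adj u w} : ℕ) : ℝ) ≤ F.ncard := by exact_mod_cast h2
    have h5 : (3 : ℝ) ≤ n := by exact_mod_cast hn
    linarith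
  refine ⟨fun a b => ?_⟩
  by_contra hab
  let X : Finset V := {x | (G.deleteEdges F).Reachable a x}
  have m1 := big X ⟨a, by simp [X]⟩ fun u hu w hw => by
    simp only [X, mem_filter, mem_univ, true_and] at hu ⊢
    exact hu.trans hw.reachable
  have m2 := big Xᶜ ⟨b, by simpa [X] using hab⟩ fun u hu w hw => by
    simp only [X, mem_filter, mem_univ, true_and, mem_compl] at hu ⊢
    exact fun h => hu (h.trans hw.symm.reachable)
  have h := card_add_card_compl X
  obtain ⟨m, rfl⟩ : ∃ m, n = m + 1 := ⟨n - 1, by omega⟩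
  rw [hcard, pow_succ] at h
  simp only [Nat.add_sub_cancel] at m1 m2
  omega
end

section
/- Let n ≥ 1 and let g be an integer with 1 ≤ g ≤ 2^n − 1. Write g in binary as g = Σ_{i=0}^s 2^{t_i} with t_0 > t_1 > ... > t_s ≥ 0, and set 2·e_g = Σ_{i=0}^s (t_i + 2i)·2^{t_i}. Then n·g − 2·e_g ≥ n. -/
theorem sum_two_pow_lt_of_strictAnti {s : ℕ} (n : ℕ) (t : Fin (s + 1) → ℕ)
    (ht : StrictAnti t) (h : t 0 < n) : ∑ i, 2 ^ t i < 2 ^ n := by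
  calc ∑ i, 2 ^ t i = ∑ k ∈ Finset.univ.image t, 2 ^ k :=
        (Finset.sum_image ht.injective.injOn).symm
    _ < 2 ^ n := Nat.geomSum_lt le_rfl (by
        simp only [Finset.mem_image, Finset.mem_univ, true_and, forall_exists_index,
          forall_apply_eq_imp_iff]
        exact fun i => (ht.antitone (Fin.zero_le i)).trans_lt h)

theorem le_mul_sum_sub_of_strictAnti {s : ℕ} (n : ℕ) (t : Fin (s + 1) → ℕ)
    (ht : StrictAnti t) (h : t 0 < n) :
    (n : ℤ) ≤ n * ∑ i, (2 : ℤ) ^ t i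
      - ∑ i : Fin (s + 1), ((t i : ℤ) + 2 * (i : ℕ)) * 2 ^ t i := by
  induction s generalizing n with
  | zero =>
    have hpow : (t 0 : ℤ) + 1 ≤ 2 ^ t 0 := mod_cast Nat.lt_two_pow_self (n := t 0)
    have hn : (t 0 : ℤ) + 1 ≤ n := mod_cast h
    simp only [Nat.reduceAdd, Finset.univ_unique, Fin.default_eq_zero, Finset.sum_singleton,
      Fin.val_zero]
    push_cast
    nlinarith
  | succ s ih =>
    have hu : StrictAnti fun i : Fin (s + 1) => t i.succ :=
      fun _ _ hij => ht (Fin.succ_lt_succ_iff.mpr hij)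
    have hlt : t (Fin.succ 0) < t 0 := ht (Fin.succ_pos 0)
    have hind := ih (t 0) _ hu hlt
    have hsum : (∑ i : Fin (s + 1), (2 : ℤ) ^ t i.succ) + 1 ≤ 2 ^ t 0 :=
      mod_cast sum_two_pow_lt_of_strictAnti (t 0) _ hu hlt
    have hnonneg : (0 : ℤ) ≤ ∑ i : Fin (s + 1), (2 : ℤ) ^ t i.succ := by positivity
    have hn : (t 0 : ℤ) + 1 ≤ n := mod_cast h
    have hshift : ∑ i : Fin (s + 1), ((t i.succ : ℤ) + 2 * (i.succ : ℕ)) * 2 ^ t i.succ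
        = ∑ i : Fin (s + 1), ((t i.succ : ℤ) + 2 * (i : ℕ)) * 2 ^ t i.succ
          + 2 * ∑ i : Fin (s + 1), (2 : ℤ) ^ t i.succ := by
      rw [Finset.mul_sum, ← Finset.sum_add_distrib]
      refine Finset.sum_congr rfl fun i _ => ?_
      push_cast [Fin.val_succ]
      ring
    rw [Fin.sum_univ_succ, Fin.sum_univ_succ (n := s + 1), hshift]
    simp only [Fin.val_zero, Nat.cast_zero, mul_zero, add_zero]
    nlinarith [mul_nonneg (sub_nonneg.mpr hn)
      (add_nonneg hnonneg (hnonneg.trans (le_sub_iff_add_le.mpr hsum)))]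


/-- Lemma 2.4: if `1 ≤ g ≤ 2^n - 1` with binary expansion `g = ∑_{i=0}^s 2^(t i)`
(`t 0 > t 1 > ... > t s ≥ 0`), and `2 e_g = ∑_{i=0}^s (t i + 2 i) * 2^(t i)`, then
`n * g - 2 * e_g ≥ n`. -/
theorem f_ge_n_of_binary_expansion
    (n : ℕ) (hn : 1 ≤ n) (g : ℕ) (hg1 : 1 ≤ g) (hg2 : g ≤ 2 ^ n - 1)
    (s : ℕ) (t : Fin (s + 1) → ℕ) (ht : StrictAnti t)
    (hsum : g = ∑ i, 2 ^ (t i)) :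
    (n : ℤ) ≤ (n : ℤ) * g - ∑ i : Fin (s + 1), ((t i : ℤ) + 2 * (i : ℕ)) * 2 ^ (t i) := by
  have hlt : t 0 < n := by
    refine (Nat.pow_lt_pow_iff_right one_lt_two).mp ?_
    calc 2 ^ t 0 ≤ ∑ i, 2 ^ t i :=
          Finset.single_le_sum (f := fun i => 2 ^ t i) (fun _ _ => Nat.zero_le _)
            (Finset.mem_univ 0)
      _ < 2 ^ n := by omega
  subst hsum
  push_cast
  exact le_mul_sum_sub_of_strictAnti n t ht hlt
end

section
/- Let n ≥ 2 and let g be an integer with 1 ≤ g ≤ 2^{n−2}. Write g in binary as g = Σ_{i=0}^s 2^{t_i} with t_0 > t_1 > ... > t_s ≥ 0, and set 2·e_g = Σ_{i=0}^s (t_i + 2i)·2^{t_i}. Then (n−2)·g − 2·e_g ≥ 0. -/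
theorem sum_two_pow_lt_of_injective {k a : ℕ} {t : Fin k → ℕ} (ht : Function.Injective t)
    (ha : ∀ i, t i < a) : ∑ i, 2 ^ t i < 2 ^ a := by
  have h := Nat.geomSum_lt (m := 2) (n := a) (s := Finset.univ.map ⟨t, ht⟩) le_rfl
    (by simpa using ha)
  simpa [Finset.sum_map] using h

theorem sum_add_two_mul_two_pow_le {k : ℕ} (m : ℕ) (t : Fin k → ℕ) (ht : StrictAnti t)
    (hm : ∑ i, 2 ^ t i ≤ 2 ^ m) :
    ∑ i : Fin k, (t i + 2 * (i : ℕ)) * 2 ^ t i ≤ m * ∑ i, 2 ^ t i := by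
  induction k generalizing m with
  | zero => simp
  | succ k ih =>
    have htail : StrictAnti fun i : Fin k => t i.succ := fun i j hij => ht (by simpa using hij)
    have hlt := sum_two_pow_lt_of_injective htail.injective fun i => ht i.succ_pos
    have hE := ih (t 0) _ htail hlt.le
    have hshift : ∑ i : Fin k, (t i.succ + 2 * (i.succ : ℕ)) * 2 ^ t i.succ =
        ∑ i : Fin k, (t i.succ + 2 * (i : ℕ)) * 2 ^ t i.succ + 2 * ∑ i : Fin k, 2 ^ t i.succ := by
      rw [Finset.mul_sum, ← Finset.sum_add_distrib]
      refine Finset.sum_congr rfl fun i _ => ?_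
      rw [Fin.val_succ]
      ring
    rw [Fin.sum_univ_succ] at hm ⊢
    rw [Fin.sum_univ_succ, hshift]
    simp only [Fin.val_zero, mul_zero, add_zero]
    generalize ∑ i : Fin k, 2 ^ t i.succ = r at *
    have ha : t 0 ≤ m := (Nat.pow_le_pow_iff_right one_lt_two).1 (by omega)
    rcases ha.eq_or_lt with rfl | ha
    · obtain rfl : r = 0 := by omega
      simpa using hE
    · nlinarith [Nat.mul_le_mul_right (2 ^ t 0 + r) ha]

/-- Lemma 2.5: if `1 ≤ g ≤ 2^(n-2)` with binary expansion `g = ∑_{i=0}^s 2^(t i)`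
(`t 0 > t 1 > ... > t s ≥ 0`), and `2 e_g = ∑_{i=0}^s (t i + 2 i) * 2^(t i)`, then
`(n - 2) * g - 2 * e_g ≥ 0`. -/
theorem f_sub_two_nonneg_of_binary_expansion
    (n : ℕ) (hn : 2 ≤ n) (g : ℕ) (hg1 : 1 ≤ g) (hg2 : g ≤ 2 ^ (n - 2))
    (s : ℕ) (t : Fin (s + 1) → ℕ) (ht : StrictAnti t)
    (hsum : g = ∑ i, 2 ^ (t i)) :
    (0 : ℤ) ≤ ((n : ℤ) - 2) * g - ∑ i : Fin (s + 1), ((t i : ℤ) + 2 * (i : ℕ)) * 2 ^ (t i) := by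
  subst hsum
  have h := sum_add_two_mul_two_pow_le (n - 2) t ht hg2
  zify [hn] at h
  push_cast
  linarith
end

section
/- Let n ≥ 2 and let k, g be integers with 0 ≤ k ≤ n−2 and 2^k ≤ g < 2^{k+1}. Write g in binary as g = Σ_{i=0}^s 2^{t_i} with t_0 > t_1 > ... > t_s ≥ 0 (so t_0 = k), and set 2·e_g = Σ_{i=0}^s (t_i + 2i)·2^{t_i}. Then n·g − 2·e_g ≥ 2^k·(n−k). -/
/-- A lower bound for the weighted sum over the tail of a binary expansion whose exponents
are all below `m`. -/
theorem mul_two_pow_le_sum_of_strictAnti (r : ℕ) :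
    ∀ (t : Fin r → ℕ) (m : ℕ) (c e : ℤ), StrictAnti t → (∀ i, t i < m) → e ≤ 0 → e ≤ c - m →
      e * 2 ^ m ≤ ∑ i : Fin r, (c - t i - 2 * (i : ℕ)) * 2 ^ t i := by
  induction r with
  | zero =>
    intro t m c e _ _ he _
    simpa using mul_nonpos_of_nonpos_of_nonneg he (by positivity : (0 : ℤ) ≤ 2 ^ m)
  | succ r ih =>
    intro t m c e ht hm he hec
    have h0 := hm 0
    have tail := ih (fun i => t i.succ) (t 0) (c - 2) (min 0 (c - t 0 - 2))
      (fun i j hij => ht (Fin.succ_lt_succ_iff.2 hij)) (fun i => ht (Fin.succ_pos i))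
      (min_le_left _ _) (by have := min_le_right 0 (c - t 0 - 2); linarith)
    have tail_eq : ∑ i : Fin r, (c - t i.succ - 2 * (i.succ : ℕ)) * (2 : ℤ) ^ t i.succ
        = ∑ i : Fin r, (c - 2 - t i.succ - 2 * (i : ℕ)) * 2 ^ t i.succ := by
      refine Finset.sum_congr rfl fun i _ => ?_
      rw [Fin.val_succ]; push_cast; ring
    rw [Fin.sum_univ_succ, tail_eq, Fin.val_zero]
    have hpos : (0 : ℤ) < 2 ^ t 0 := by positivity
    have hpow : (2 : ℤ) ^ t 0 * 2 ≤ 2 ^ m := by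
      rw [← pow_succ]; exact pow_le_pow_right₀ (by norm_num) h0
    have hx : e + 1 ≤ c - t 0 := by omega
    have hle : e * 2 ^ m ≤ e * (2 ^ t 0 * 2) := mul_le_mul_of_nonpos_left hpow he
    have hmin : 2 * e ≤ (c - t 0) + min 0 (c - t 0 - 2) := by omega
    have := mul_le_mul_of_nonneg_right hmin hpos.le
    push_cast
    linarith

/-- The largest exponent of a binary expansion is determined by its dyadic range. -/
theorem strictAnti_apply_zero_eq_of_sum_two_pow {s k : ℕ} {t : Fin (s + 1) → ℕ}
    (ht : StrictAnti t) (h1 : 2 ^ k ≤ ∑ i, 2 ^ t i) (h2 : ∑ i, 2 ^ t i < 2 ^ (k + 1)) :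
    t 0 = k := by
  have upper : 2 ^ t 0 ≤ ∑ i, 2 ^ t i :=
    Finset.single_le_sum (f := fun i => 2 ^ t i) (fun _ _ => Nat.zero_le _) (Finset.mem_univ 0)
  have lower : ∑ i, 2 ^ t i < 2 ^ (t 0 + 1) := by
    rw [← Finset.sum_image (f := fun j => 2 ^ j) fun _ _ _ _ h => ht.injective h]
    refine Nat.geomSum_lt le_rfl fun j hj => ?_
    obtain ⟨i, -, rfl⟩ := Finset.mem_image.1 hj
    exact Nat.lt_succ_of_le (ht.antitone (Fin.zero_le i))
  have := (Nat.pow_lt_pow_iff_right (by norm_num : 1 < 2)).1 (upper.trans_lt h2)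
  have := (Nat.pow_lt_pow_iff_right (by norm_num : 1 < 2)).1 (h1.trans_lt lower)
  omega


/-- First claim in the proof of Lemma 2.6: if `0 ≤ k ≤ n - 2` and `2^k ≤ g < 2^(k+1)`,
with binary expansion `g = ∑_{i=0}^s 2^(t i)` (`t 0 > t 1 > ... > t s ≥ 0`, so `t 0 = k`)
and `2 e_g = ∑_{i=0}^s (t i + 2 i) * 2^(t i)`, then `n * g - 2 e_g ≥ 2^k (n - k)`. -/
theorem f_ge_f_pow_of_same_leading_bit
    (n k : ℕ) (hn : 2 ≤ n) (hk : k + 2 ≤ n)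
    (g : ℕ) (hg1 : 2 ^ k ≤ g) (hg2 : g < 2 ^ (k + 1))
    (s : ℕ) (t : Fin (s + 1) → ℕ) (ht : StrictAnti t)
    (hsum : g = ∑ i, 2 ^ (t i)) :
    2 ^ k * ((n : ℤ) - k) ≤ (n : ℤ) * g - ∑ i : Fin (s + 1), ((t i : ℤ) + 2 * (i : ℕ)) * 2 ^ (t i) := by
  subst hsum
  have h0 : t 0 = k := strictAnti_apply_zero_eq_of_sum_two_pow ht hg1 hg2
  have tail := mul_two_pow_le_sum_of_strictAnti s (fun i => t i.succ) k (n - 2) 0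
    (fun i j hij => ht (Fin.succ_lt_succ_iff.2 hij)) (fun i => h0 ▸ ht (Fin.succ_pos i))
    le_rfl (by omega)
  have split : (n : ℤ) * (∑ i, 2 ^ t i : ℕ)
      - ∑ i : Fin (s + 1), ((t i : ℤ) + 2 * (i : ℕ)) * 2 ^ t i
      = 2 ^ k * ((n : ℤ) - k)
        + ∑ i : Fin s, ((n : ℤ) - 2 - t i.succ - 2 * (i : ℕ)) * 2 ^ t i.succ := by
    push_cast
    rw [Finset.mul_sum, ← Finset.sum_sub_distrib, Fin.sum_univ_succ, h0, Fin.val_zero]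
    congr 1
    · push_cast; ring
    · refine Finset.sum_congr rfl fun i _ => ?_
      rw [Fin.val_succ]; push_cast; ring
  rw [split]
  linarith
end

section
/- Let n ≥ 1 and let G be any n-dimensional hypercube-like network (G ∈ HL_n). Then the edge connectivity of G equals n; that is, for every set S of edges of G with |S| < n the graph G − S is connected, and there exists a set S of exactly n edges of G such that G − S is disconnected. -/
theorem IsHL.natCard_eq {n : ℕ} {V : Type} [Fintype V] [DecidableEq V]
    {G : SimpleGraph V} (hG : IsHL n G) : Nat.card V = 2 ^ n := by
  induction n generalizing V with
  | zero => simpa [IsHL] using hG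
  | succ n ih =>
    obtain ⟨S, h₀, h₁, -, -⟩ := hG
    have c₀ : S.card = 2 ^ n := by simpa using ih h₀
    have c₁ : Sᶜ.card = 2 ^ n := by
      rw [← ih h₁, Nat.card_coe_set_eq, Set.ncard_coe_finset]
    rw [Nat.card_eq_fintype_card, ← Finset.card_add_card_compl S, c₀, c₁, pow_succ, mul_two]

theorem SimpleGraph.ncard_neighborSet_of_existsUnique_notMem {V : Type*} [Finite V]
    {G : SimpleGraph V} {A : Set V} {v : V} (hv : v ∈ A)
    (h : ∃! w, w ∉ A ∧ G.Adj v w) :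
    (G.neighborSet v).ncard = ((G.induce A).neighborSet ⟨v, hv⟩).ncard + 1 := by
  obtain ⟨w, ⟨hwA, hvw⟩, huniq⟩ := h
  have key : G.neighborSet v =
      insert w (Subtype.val '' (G.induce A).neighborSet ⟨v, hv⟩) := by
    ext x
    simp only [SimpleGraph.mem_neighborSet, Set.mem_insert_iff, Set.mem_image,
      SimpleGraph.comap_adj, Function.Embedding.subtype_apply, Subtype.exists, exists_and_right,
      exists_eq_right]
    constructor
    · intro hx
      by_cases hxA : x ∈ A
      · exact Or.inr ⟨hxA, hx⟩
      · exact Or.inl (huniq x ⟨hxA, hx⟩)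
    · rintro (rfl | ⟨-, hx⟩)
      · exact hvw
      · exact hx
  rw [key, Set.ncard_insert_of_notMem, Set.ncard_image_of_injective _ Subtype.val_injective]
  rintro ⟨x, -, rfl⟩
  exact hwA x.2

theorem SimpleGraph.reachable_deleteEdges_of_induce {V : Type*} {G : SimpleGraph V} {A : Set V}
    {T : Set (Sym2 V)}
    (h : ((G.induce A).deleteEdges (Sym2.map Subtype.val ⁻¹' T)).Connected)
    {u v : V} (hu : u ∈ A) (hv : v ∈ A) : (G.deleteEdges T).Reachable u v := by
  let f : (G.induce A).deleteEdges (Sym2.map Subtype.val ⁻¹' T) →g G.deleteEdges T :=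
    ⟨Subtype.val, fun {a b} hab => by
      simpa [SimpleGraph.deleteEdges_adj] using hab⟩
  exact (h.preconnected ⟨u, hu⟩ ⟨v, hv⟩).map f

theorem Sym2.mem_of_ncard_le_ncard_preimage {V : Type*} [Finite V] {A : Set V} {T : Set (Sym2 V)}
    (h : T.ncard ≤ (Sym2.map (Subtype.val : A → V) ⁻¹' T).ncard)
    {e : Sym2 V} (he : e ∈ T) {x : V} (hx : x ∈ e) : x ∈ A := by
  have himg : Sym2.map (Subtype.val : A → V) '' (Sym2.map Subtype.val ⁻¹' T) = T := by
    apply Set.eq_of_subset_of_ncard_le (Set.image_preimage_subset _ _)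
    rwa [Set.ncard_image_of_injective _ (Sym2.map.injective Subtype.val_injective)]
  rw [← himg] at he
  obtain ⟨e', -, rfl⟩ := he
  obtain ⟨y, -, rfl⟩ := Sym2.mem_map.mp hx
  exact y.2

/-- If every edge of `T` lies inside `A`, every vertex of `A` has a neighbour in `Aᶜ`, and the
subgraph induced by `Aᶜ` is connected after deleting `T`, then deleting `T` keeps the whole graph
connected. -/
theorem SimpleGraph.connected_deleteEdges_of_subset_side {V : Type*} {G : SimpleGraph V}
    {A B : Set V} (hAB : ∀ v, v ∉ B ↔ v ∈ A) {T : Set (Sym2 V)}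
    (hT : ∀ e ∈ T, ∀ x ∈ e, x ∈ A)
    (hB : Sym2.map (Subtype.val : B → V) ⁻¹' T = ∅ →
      ((G.induce B).deleteEdges (Sym2.map Subtype.val ⁻¹' T)).Connected)
    (hm : ∀ v ∈ A, ∃ w ∈ B, G.Adj v w) : (G.deleteEdges T).Connected := by
  have hconn := hB <| Set.eq_empty_iff_forall_notMem.mpr fun e he => by
    induction e with
    | _ x y => exact (hAB x).mpr (hT _ he x (by simp)) x.2
  have hreach : ∀ v, ∃ w ∈ B, (G.deleteEdges T).Reachable v w := fun v => by
    by_cases hv : v ∈ B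
    · exact ⟨v, hv, .refl v⟩
    · obtain ⟨w, hw, hvw⟩ := hm v ((hAB v).mp hv)
      refine ⟨w, hw, SimpleGraph.Adj.reachable ?_⟩
      rw [SimpleGraph.deleteEdges_adj]
      exact ⟨hvw, fun he => (hAB w).mpr (hT _ he w (by simp)) hw⟩
  obtain ⟨b⟩ := hconn.nonempty
  have : Nonempty V := ⟨b⟩
  refine ⟨fun u v => ?_⟩
  obtain ⟨u', hu', hu⟩ := hreach u
  obtain ⟨v', hv', hv⟩ := hreach v
  exact (hu.trans (reachable_deleteEdges_of_induce hconn hu' hv')).trans hv.symm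

/-- If both sides of a partition stay connected and an edge between them survives, the whole graph
stays connected. -/
theorem SimpleGraph.connected_deleteEdges_of_sides {V : Type*} {G : SimpleGraph V}
    {A B : Set V} (hAB : ∀ v, v ∉ A → v ∈ B) {T : Set (Sym2 V)}
    (hA : ((G.induce A).deleteEdges (Sym2.map Subtype.val ⁻¹' T)).Connected)
    (hB : ((G.induce B).deleteEdges (Sym2.map Subtype.val ⁻¹' T)).Connected)
    {a b : V} (ha : a ∈ A) (hb : b ∈ B) (hab : (G.deleteEdges T).Adj a b) :
    (G.deleteEdges T).Connected := by
  have : Nonempty V := ⟨a⟩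
  have hreach : ∀ v, (G.deleteEdges T).Reachable v a := fun v => by
    by_cases hv : v ∈ A
    · exact reachable_deleteEdges_of_induce hA hv ha
    · exact (reachable_deleteEdges_of_induce hB (hAB v hv) hb).trans hab.reachable.symm
  exact ⟨fun u v => (hreach u).trans (hreach v).symm⟩

theorem SimpleGraph.exists_adj_deleteEdges_of_ncard_lt {V : Type*} [Finite V] {G : SimpleGraph V}
    {A : Set V} {T : Set (Sym2 V)} (hT : T.ncard < A.ncard)
    (hm : ∀ v ∈ A, ∃ w, w ∉ A ∧ G.Adj v w) :
    ∃ a ∈ A, ∃ b ∉ A, (G.deleteEdges T).Adj a b := by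
  by_contra! hcon
  choose! m hmA hadj using hm
  refine hT.not_ge (Set.ncard_le_ncard_of_injOn (fun v => s(v, m v)) (fun v hv => ?_) ?_)
  · by_contra he
    exact hcon v hv (m v) (hmA v hv) (SimpleGraph.deleteEdges_adj.mpr ⟨hadj v hv, he⟩)
  · intro u hu v hv huv
    rcases Sym2.eq_iff.mp huv with ⟨h, -⟩ | ⟨h, -⟩
    · exact h
    · exact absurd (h ▸ hu) (hmA v hv)

theorem IsHL.connected_deleteEdges {n : ℕ} {V : Type} [Fintype V] [DecidableEq V]
    {G : SimpleGraph V} (hG : IsHL n G) {T : Set (Sym2 V)} (hT : T.ncard < n ∨ T = ∅) :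
    (G.deleteEdges T).Connected := by
  induction n generalizing V with
  | zero =>
    obtain ⟨v, hv⟩ := Fintype.card_eq_one_iff.mp hG
    have : Nonempty V := ⟨v⟩
    exact ⟨fun a b => by rw [hv a, hv b]⟩
  | succ n ih =>
    have hTn : T.ncard ≤ n := by
      rcases hT with h | rfl
      · omega
      · simp
    obtain ⟨S, h₀, h₁, m₀, m₁⟩ := hG
    by_cases hA : T.ncard ≤ (Sym2.map (Subtype.val : ↥(S : Set V) → V) ⁻¹' T).ncard
    · refine SimpleGraph.connected_deleteEdges_of_subset_side
        (A := (S : Set V)) (B := ((Sᶜ : Finset V) : Set V)) (by simp)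
        (fun e he x hx => Sym2.mem_of_ncard_le_ncard_preimage hA he hx) (fun h => ih h₁ (.inr h))
        (fun v hv => ?_)
      obtain ⟨w, ⟨hw, hvw⟩, -⟩ := m₀ v hv
      exact ⟨w, by simpa using hw, hvw⟩
    by_cases hB : T.ncard ≤
        (Sym2.map (Subtype.val : ((Sᶜ : Finset V) : Set V) → V) ⁻¹' T).ncard
    · refine SimpleGraph.connected_deleteEdges_of_subset_side
        (A := ((Sᶜ : Finset V) : Set V)) (B := (S : Set V)) (by simp)
        (fun e he x hx => Sym2.mem_of_ncard_le_ncard_preimage hB he hx) (fun h => ih h₀ (.inr h))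
        (fun v hv => ?_)
      obtain ⟨w, ⟨hw, hvw⟩, -⟩ := m₁ v (by simpa using hv)
      exact ⟨w, hw, hvw⟩
    have hS : T.ncard < (S : Set V).ncard := by
      rw [← Nat.card_coe_set_eq (S : Set V), h₀.natCard_eq]
      exact hTn.trans_lt Nat.lt_two_pow_self
    obtain ⟨a, ha, b, hb, hab⟩ := SimpleGraph.exists_adj_deleteEdges_of_ncard_lt hS
      fun v hv => (m₀ v hv).exists
    exact SimpleGraph.connected_deleteEdges_of_sides (by simp) (ih h₀ (.inl (by omega)))
      (ih h₁ (.inl (by omega))) ha (by simpa using hb) hab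

/-- Lemma 2.3: the edge connectivity of any `G ∈ HL_n` equals `n`: removing fewer than `n`
edges leaves `G` connected, and some set of exactly `n` edges disconnects `G`. -/
theorem edgeConnectivity_HL
    {n : ℕ} (hn : 1 ≤ n) {V : Type} [Fintype V] [DecidableEq V]
    (G : SimpleGraph V) (hG : IsHL n G) :
    (∀ S : Set (Sym2 V), S ⊆ G.edgeSet → S.ncard < n → (G.deleteEdges S).Connected) ∧
      (∃ S : Set (Sym2 V), S ⊆ G.edgeSet ∧ S.ncard = n ∧ ¬ (G.deleteEdges S).Connected) := by
  refine ⟨fun S _ hS => hG.connected_deleteEdges (.inl hS), ?_⟩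
  obtain ⟨v⟩ := (hG.connected_deleteEdges (T := ∅) (.inr rfl)).nonempty
  refine ⟨G.incidenceSet v, G.incidenceSet_subset v, ?_, fun hconn => ?_⟩
  · rw [← hG.ncard_neighborSet v, ← Nat.card_coe_set_eq, ← Nat.card_coe_set_eq]
    exact Nat.card_congr (G.incidenceSetEquivNeighborSet v)
  · have : Nontrivial V := by
      rw [← Finite.one_lt_card_iff_nontrivial, hG.natCard_eq]
      exact Nat.one_lt_two_pow (by omega)
    obtain ⟨w, hvw⟩ := hconn.preconnected.exists_adj_of_nontrivial v
    rw [SimpleGraph.deleteEdges_adj] at hvw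
    exact hvw.2 ⟨hvw.1, by simp⟩
end
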